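/- Let R be a commutative ring and a ∈ Um_n(R) a unimodular row. Then a is the first row of some invertible matrix A ∈ GL_n(R) if and only if the kernel of the surjection R^n → R, x ↦ a·x^T, is a free R-module of rank n-1. -/

import Mathlib

open Matrix

/-- A row vector over a commutative ring `R` is unimodular if its entries generate the
unit ideal. -/
def IsUnimodular {R : Type*} [CommRing R] {n : ℕ} (a : Fin n → R) : Prop :=
  Ideal.span (Set.range a) = ⊤

/-- If `f` is the zeroth coordinate of an automorphism `e` of `R^(m+1)`, then `e` identifies the
kernel of `f` with `R^m`. -/
def kerEquivOfCoordZero {R : Type*} [CommRing R] {m : ℕ} (f : (Fin (m + 1) → R) →ₗ[R] R)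
    (e : (Fin (m + 1) → R) ≃ₗ[R] (Fin (m + 1) → R)) (h : ∀ x, e x 0 = f x) :
    LinearMap.ker f ≃ₗ[R] (Fin m → R) where
  toFun x := Fin.tail (e x)
  map_add' x y := by ext i; simp [Fin.tail]
  map_smul' c x := by ext i; simp [Fin.tail]
  invFun y := ⟨e.symm (Fin.cons 0 y), by simp [LinearMap.mem_ker, ← h]⟩
  left_inv x := by
    have hx : e x 0 = 0 := (h x).trans x.2
    ext1
    simp only [← hx, Fin.cons_self_tail, LinearEquiv.symm_apply_apply]
  right_inv y := by simp

/-- A section `g` of `f` and an identification of the kernel of `f` with `R^m` assemble to an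
automorphism of `R^(m+1)` whose zeroth coordinate is `f`. -/
def equivOfKerEquiv {R : Type*} [CommRing R] {m : ℕ} (f : (Fin (m + 1) → R) →ₗ[R] R)
    (g : R →ₗ[R] (Fin (m + 1) → R)) (hg : ∀ r, f (g r) = r)
    (k : LinearMap.ker f ≃ₗ[R] (Fin m → R)) :
    (Fin (m + 1) → R) ≃ₗ[R] (Fin (m + 1) → R) :=
  LinearEquiv.symm
    { toFun := fun y => k.symm (Fin.tail y) + g (y 0)
      map_add' := fun x y => by
        have : Fin.tail (x + y) = Fin.tail x + Fin.tail y := rfl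
        simp only [this, map_add, Pi.add_apply, Submodule.coe_add]
        abel
      map_smul' := fun c x => by
        have : Fin.tail (c • x) = c • Fin.tail x := rfl
        simp only [this, map_smul, Pi.smul_apply, Submodule.coe_smul, smul_add, RingHom.id_apply]
      invFun := fun x => Fin.cons (f x) (k ⟨x - g (f x), by simp [hg]⟩)
      left_inv := fun y => by
        have hf : f (k.symm (Fin.tail y) + g (y 0)) = y 0 := by
          rw [map_add, hg, LinearMap.mem_ker.1 (k.symm (Fin.tail y)).2, zero_add]
        simp only [hf, add_sub_cancel_right, Subtype.coe_eta, LinearEquiv.apply_symm_apply,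
          Fin.cons_self_tail]
      right_inv := fun x => by simp }

theorem equivOfKerEquiv_apply_zero {R : Type*} [CommRing R] {m : ℕ}
    (f : (Fin (m + 1) → R) →ₗ[R] R) (g : R →ₗ[R] (Fin (m + 1) → R)) (hg : ∀ r, f (g r) = r)
    (k : LinearMap.ker f ≃ₗ[R] (Fin m → R)) (x : Fin (m + 1) → R) :
    equivOfKerEquiv f g hg k x 0 = f x :=
  rfl

/-- A unimodular row `a` of length `n` is the first row of an invertible matrix if and only
if the kernel of the associated surjection `R^n → R`, `x ↦ ∑ i, a i * x i`, is a free
`R`-module of rank `n - 1`. -/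
theorem unimodular_row_completable_iff_kernel_free {R : Type*} [CommRing R] {n : ℕ}
    (hn : 0 < n) (a : Fin n → R) (ha : IsUnimodular a) :
    (∃ A : Matrix (Fin n) (Fin n) R, IsUnit A.det ∧ A ⟨0, hn⟩ = a) ↔
      Nonempty
        (LinearMap.ker (∑ i, a i • (LinearMap.proj i : (Fin n → R) →ₗ[R] R)) ≃ₗ[R]
          (Fin (n - 1) → R)) := by
  obtain ⟨m, rfl⟩ : ∃ m, n = m + 1 := ⟨n - 1, by omega⟩
  constructor
  · rintro ⟨A, hA, rfl⟩
    let := A.invertibleOfIsUnitDet hA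
    exact ⟨kerEquivOfCoordZero _ (A.toLinearEquiv' ‹_›) fun x => by
      simp [Matrix.toLinearEquiv', Matrix.mulVec, dotProduct]⟩
  · rintro ⟨k⟩
    obtain ⟨b, hb⟩ := Ideal.mem_span_range_iff_exists_fun.1 ((Ideal.eq_top_iff_one _).1 ha)
    have hg (r : R) : (∑ i, a i • (LinearMap.proj i : (Fin (m + 1) → R) →ₗ[R] R))
        (LinearMap.toSpanSingleton R _ b r) = r := by
      rw [LinearMap.toSpanSingleton_apply, map_smul]
      simp [mul_comm (a _), hb]
    let e := equivOfKerEquiv _ _ hg k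
    refine ⟨LinearMap.toMatrix' e.toLinearMap, ?_, ?_⟩
    · rw [LinearMap.det_toMatrix']
      exact e.isUnit_det'
    · ext j
      rw [LinearMap.toMatrix'_apply]
      refine (equivOfKerEquiv_apply_zero _ _ hg k _).trans ?_
      simp [Pi.single_apply]
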